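/- arXiv:1803.01034 — 3 statements merged into one kernel-verified Lean document; each statement's English description precedes it below -/
import Mathlib

section
/- Under the hypotheses of Proposition 1 (existence of a C¹ feedback k such that the closed-loop dissipation inequality ∂ₓV(x,δ)(f(x) + B(x)(k(x)+v)) + ∂_δV(x,δ)[(Df(x) + Σᵢ (kᵢ(x)+vᵢ) Dbᵢ(x))δ + B(x)Dk(x)δ] ≤ −α(V(x,δ)) holds for all x, δ ∈ ℝⁿ and all v ∈ ℝᵐ), it follows that for every x, δ ∈ ℝⁿ and every index i ∈ {1,…,m}: ∂ₓV(x,δ) bᵢ(x) + ∂_δV(x,δ) Dbᵢ(x) δ = 0. -/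
/-- Partial Fréchet derivative of `V` with respect to its first (state) argument,
as a row covector on `ℝⁿ`. -/
noncomputable def DxV {n : ℕ} (V : (Fin n → ℝ) → (Fin n → ℝ) → ℝ)
    (x δ : Fin n → ℝ) : (Fin n → ℝ) →L[ℝ] ℝ :=
  fderiv ℝ (fun y => V y δ) x

/-- Partial Fréchet derivative of `V` with respect to its second (differential)
argument, as a row covector on `ℝⁿ`. -/
noncomputable def DdV {n : ℕ} (V : (Fin n → ℝ) → (Fin n → ℝ) → ℝ)
    (x δ : Fin n → ℝ) : (Fin n → ℝ) →L[ℝ] ℝ :=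
  fderiv ℝ (fun d => V x d) δ

/-- `A(x,u) δ = Df(x) δ + ∑ i, uᵢ Dbᵢ(x) δ`, where `B x i` is the `i`-th column
`bᵢ(x)` of the input matrix `B(x)`. -/
noncomputable def Amap {n m : ℕ} (f : (Fin n → ℝ) → (Fin n → ℝ))
    (B : (Fin n → ℝ) → Fin m → (Fin n → ℝ)) (x : Fin n → ℝ) (u : Fin m → ℝ)
    (δ : Fin n → ℝ) : Fin n → ℝ :=
  fderiv ℝ f x δ + ∑ i, u i • fderiv ℝ (fun y => B y i) x δ

/-- Under the hypotheses of Proposition 1, boundedness in `v` of the affine-in-`v`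
dissipation inequality forces the linear part to vanish:
`∂ₓV(x,δ) bᵢ(x) + ∂_δV(x,δ) Dbᵢ(x) δ = 0` for every `x`, `δ` and `i`. -/
theorem vanishing_linear_part {n m : ℕ} (f : (Fin n → ℝ) → (Fin n → ℝ))
    (B : (Fin n → ℝ) → Fin m → (Fin n → ℝ))
    (k : (Fin n → ℝ) → (Fin m → ℝ)) (V : (Fin n → ℝ) → (Fin n → ℝ) → ℝ)
    (α : ℝ → ℝ)
    (hf : ContDiff ℝ 1 f) (hB : ∀ i, ContDiff ℝ (⊤ : ℕ∞) (fun x => B x i))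
    (hk : ContDiff ℝ 1 k)
    (hV : ContDiff ℝ 1 (fun q : (Fin n → ℝ) × (Fin n → ℝ) => V q.1 q.2))
    (hVnn : ∀ x δ, 0 ≤ V x δ) (hαnn : ∀ s, 0 ≤ s → 0 ≤ α s)
    (hclosed : ∀ (x δ : Fin n → ℝ) (v : Fin m → ℝ),
      DxV V x δ (f x + ∑ i, (k x i + v i) • B x i)
        + DdV V x δ (Amap f B x (k x + v) δ + ∑ i, fderiv ℝ k x δ i • B x i)
      ≤ -α (V x δ)) :
    ∀ (x δ : Fin n → ℝ) (i : Fin m),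
      DxV V x δ (B x i) + DdV V x δ (fderiv ℝ (fun y => B y i) x δ) = 0 := by
  intro x δ i
  set c := DxV V x δ (B x i) + DdV V x δ (fderiv ℝ (fun y => B y i) x δ) with hc
  obtain ⟨a, ha⟩ : ∃ a : ℝ, ∀ t : ℝ, a + t * c ≤ -α (V x δ) := by
    refine ⟨DxV V x δ (f x + ∑ i, k x i • B x i)
        + DdV V x δ (Amap f B x (k x) δ + ∑ i, fderiv ℝ k x δ i • B x i), fun t => ?_⟩
    have h := hclosed x δ (Pi.single i t)
    have e1 : ∑ j, (Pi.single i t : Fin m → ℝ) j • B x j = t • B x i := by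
      rw [Finset.sum_eq_single i] <;> simp +contextual [Pi.single_apply]
    have e2 : ∑ j, (Pi.single i t : Fin m → ℝ) j • fderiv ℝ (fun y => B y j) x δ
        = t • fderiv ℝ (fun y => B y i) x δ := by
      rw [Finset.sum_eq_single i] <;> simp +contextual [Pi.single_apply]
    simp only [Amap, Pi.add_apply, add_smul, Finset.sum_add_distrib, e1, e2] at h
    simp only [Amap, hc]
    simp only [map_add, map_smul, smul_eq_mul] at h ⊢
    linarith
  by_contra hne
  have h := ha ((-α (V x δ) - a + 1) / c)
  rw [div_mul_cancel₀ _ hne] at h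
  linarith
end

section
/- The function ρ : ℝ² → ℝ defined by ρ(a,b) = (a + √(a² + b²))/b for b ≠ 0 and ρ(a,b) = 0 for b = 0 is C^∞ (smooth) on the open set D = {(a,b) ∈ ℝ² : b ≠ 0 or a < 0}; indeed, for every (a,b) ∈ D one has √(a² + b²) − a > 0 and ρ(a,b) = b/(√(a² + b²) − a), which is smooth on D. -/
/-- Sontag's universal-formula gain, with the removable singularity at `b = 0`
filled in by `0`. -/
noncomputable def sontagRho (q : ℝ × ℝ) : ℝ :=
  if q.2 = 0 then 0 else (q.1 + Real.sqrt (q.1 ^ 2 + q.2 ^ 2)) / q.2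

/-- The open set `D = {(a,b) : b ≠ 0 ∨ a < 0}`. -/
def sontagDomain : Set (ℝ × ℝ) := {q : ℝ × ℝ | q.2 ≠ 0 ∨ q.1 < 0}

/-- The gain `ρ(a,b) = (a + √(a² + b²))/b` (set to `0` when `b = 0`) is C^∞ on
`D = {b ≠ 0 ∨ a < 0}`: indeed on `D` one has `√(a² + b²) − a > 0` and
`ρ(a,b) = b / (√(a² + b²) − a)`, which is smooth on `D`. -/
theorem sontagRho_smoothOn :
    ContDiffOn ℝ (⊤ : ℕ∞) sontagRho sontagDomain ∧
    ∀ q ∈ sontagDomain,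
      0 < Real.sqrt (q.1 ^ 2 + q.2 ^ 2) - q.1 ∧
      sontagRho q = q.2 / (Real.sqrt (q.1 ^ 2 + q.2 ^ 2) - q.1) := by
  have key : ∀ q ∈ sontagDomain,
      0 < Real.sqrt (q.1 ^ 2 + q.2 ^ 2) - q.1 ∧
      sontagRho q = q.2 / (Real.sqrt (q.1 ^ 2 + q.2 ^ 2) - q.1) := by
    rintro ⟨a, b⟩ hq
    simp only [sontagDomain, Set.mem_setOf_eq] at hq
    have hpos : 0 < Real.sqrt (a ^ 2 + b ^ 2) - a := by
      rw [sub_pos]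
      rcases hq with hb | ha
      · apply Real.lt_sqrt_of_sq_lt
        have : 0 < b ^ 2 := by positivity
        linarith
      · exact lt_of_lt_of_le ha (Real.sqrt_nonneg _)
    refine ⟨hpos, ?_⟩
    by_cases hb : b = 0
    · simp [sontagRho, hb]
    · have hs : Real.sqrt (a ^ 2 + b ^ 2) ^ 2 = a ^ 2 + b ^ 2 :=
        Real.sq_sqrt (by positivity)
      simp only [sontagRho, hb, if_false]
      rw [div_eq_div_iff hb hpos.ne']
      linear_combination hs
  refine ⟨?_, key⟩
  have hsm : ContDiffOn ℝ (⊤ : ℕ∞)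
      (fun q : ℝ × ℝ => q.2 / (Real.sqrt (q.1 ^ 2 + q.2 ^ 2) - q.1)) sontagDomain := by
    refine ContDiffOn.div contDiff_snd.contDiffOn (ContDiffOn.sub (ContDiffOn.sqrt ?_ ?_)
      contDiff_fst.contDiffOn) (fun q hq => (key q hq).1.ne')
    · exact ((contDiff_fst.pow 2).add (contDiff_snd.pow 2)).contDiffOn
    · rintro q (hb | ha)
      · have : 0 < q.2 ^ 2 := by positivity
        have := sq_nonneg q.1
        linarith
      · have : 0 < q.1 ^ 2 := by nlinarith
        have := sq_nonneg q.2
        linarith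
  exact hsm.congr (fun q hq => (key q hq).2)
end

section
/- Suppose condition (CCM) holds: for every x ∈ ℝⁿ, u ∈ ℝᵐ and δ ≠ 0, ∂_δV(x,δ)B(x) = 0 implies a₀(x,δ,u) < −α(V(x,δ)), where a₀(x,δ,u) = ∂ₓV(x,δ)(f(x)+B(x)u) + ∂_δV(x,δ)A(x,u)δ. Define a(x,δ,u) = a₀(x,δ,u) + α(V(x,δ)), b(x,δ) = ∂_δV(x,δ)B(x)B(x)ᵀ∂_δV(x,δ)ᵀ, ρ = 0 if a < 0 and ρ = (a + √(a² + b²))/b otherwise, and the differential feedback k_δ(x,δ,u) = −ρ(x,δ,u) B(x)ᵀ ∂_δV(x,δ)ᵀ ∈ ℝᵐ. Then for every x ∈ ℝⁿ, u ∈ ℝᵐ and δ ≠ 0: ∂ₓV(x,δ)(f(x)+B(x)u) + ∂_δV(x,δ)(A(x,u)δ + B(x) k_δ(x,δ,u)) < −α(V(x,δ)). -/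
/-- `a(x,δ,u) = ∂ₓV(x,δ)(f(x)+B(x)u) + ∂_δV(x,δ) A(x,u) δ + α(V(x,δ))`. -/
noncomputable def aCCM {n m : ℕ} (f : (Fin n → ℝ) → (Fin n → ℝ))
    (B : (Fin n → ℝ) → Fin m → (Fin n → ℝ)) (V : (Fin n → ℝ) → (Fin n → ℝ) → ℝ)
    (α : ℝ → ℝ) (x δ : Fin n → ℝ) (u : Fin m → ℝ) : ℝ :=
  DxV V x δ (f x + ∑ i, u i • B x i) + DdV V x δ (Amap f B x u δ) + α (V x δ)

/-- `b(x,δ) = ∂_δV(x,δ) B(x) B(x)ᵀ ∂_δV(x,δ)ᵀ = ∑ i, (∂_δV(x,δ) bᵢ(x))²`. -/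
noncomputable def bCCM {n m : ℕ} (B : (Fin n → ℝ) → Fin m → (Fin n → ℝ))
    (V : (Fin n → ℝ) → (Fin n → ℝ) → ℝ) (x δ : Fin n → ℝ) : ℝ :=
  ∑ i, (DdV V x δ (B x i)) ^ 2

/-- Sontag-type gain `ρ = 0` if `a < 0`, `ρ = (a + √(a² + b²))/b` otherwise. -/
noncomputable def rhoCCM {n m : ℕ} (f : (Fin n → ℝ) → (Fin n → ℝ))
    (B : (Fin n → ℝ) → Fin m → (Fin n → ℝ)) (V : (Fin n → ℝ) → (Fin n → ℝ) → ℝ)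
    (α : ℝ → ℝ) (x δ : Fin n → ℝ) (u : Fin m → ℝ) : ℝ :=
  if aCCM f B V α x δ u < 0 then 0
  else (aCCM f B V α x δ u +
    Real.sqrt ((aCCM f B V α x δ u) ^ 2 + (bCCM B V x δ) ^ 2)) / bCCM B V x δ

/-- Differential feedback `k_δ(x,δ,u) = −ρ(x,δ,u) B(x)ᵀ ∂_δV(x,δ)ᵀ ∈ ℝᵐ`. -/
noncomputable def kDelta {n m : ℕ} (f : (Fin n → ℝ) → (Fin n → ℝ))
    (B : (Fin n → ℝ) → Fin m → (Fin n → ℝ)) (V : (Fin n → ℝ) → (Fin n → ℝ) → ℝ)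
    (α : ℝ → ℝ) (x δ : Fin n → ℝ) (u : Fin m → ℝ) : Fin m → ℝ :=
  fun i => -(rhoCCM f B V α x δ u) * DdV V x δ (B x i)

/-- **Dissipativity of the differential feedback.** Under condition (CCM), the
differential feedback `k_δ` makes `V̇` strictly less than `-α(V)` along the
closed-loop differential dynamics, for every `x`, `u` and `δ ≠ 0`. -/
theorem kDelta_dissipative {n m : ℕ} (f : (Fin n → ℝ) → (Fin n → ℝ))
    (B : (Fin n → ℝ) → Fin m → (Fin n → ℝ)) (V : (Fin n → ℝ) → (Fin n → ℝ) → ℝ)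
    (α : ℝ → ℝ)
    (hf : ContDiff ℝ 1 f) (hB : ∀ i, ContDiff ℝ 1 (fun x => B x i))
    (hV : ContDiff ℝ 1 (fun q : (Fin n → ℝ) × (Fin n → ℝ) => V q.1 q.2))
    (hVnn : ∀ x δ, 0 ≤ V x δ) (hαnn : ∀ s, 0 ≤ s → 0 ≤ α s)
    (hCCM : ∀ (x : Fin n → ℝ) (u : Fin m → ℝ) (δ : Fin n → ℝ), δ ≠ 0 →
      (∀ i, DdV V x δ (B x i) = 0) →
      DxV V x δ (f x + ∑ i, u i • B x i) + DdV V x δ (Amap f B x u δ)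
        < -α (V x δ)) :
    ∀ (x : Fin n → ℝ) (u : Fin m → ℝ) (δ : Fin n → ℝ), δ ≠ 0 →
      DxV V x δ (f x + ∑ i, u i • B x i) +
        DdV V x δ (Amap f B x u δ + ∑ i, kDelta f B V α x δ u i • B x i)
        < -α (V x δ) := by
  intro x u δ hδ
  have hsum : DdV V x δ (∑ i, kDelta f B V α x δ u i • B x i)
      = -(rhoCCM f B V α x δ u * bCCM B V x δ) := by
    rw [map_sum, bCCM, Finset.mul_sum, ← Finset.sum_neg_distrib]
    refine Finset.sum_congr rfl fun i _ => ?_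
    rw [map_smul, smul_eq_mul, kDelta]
    ring
  rw [map_add (DdV V x δ), hsum]
  have ha : aCCM f B V α x δ u = DxV V x δ (f x + ∑ i, u i • B x i)
      + DdV V x δ (Amap f B x u δ) + α (V x δ) := rfl
  by_cases hneg : aCCM f B V α x δ u < 0
  · have hr : rhoCCM f B V α x δ u = 0 := if_pos hneg
    rw [hr]
    linarith
  · have hb0 : bCCM B V x δ ≠ 0 := by
      intro h0
      apply hneg
      have h1 : ∀ i, DdV V x δ (B x i) = 0 := by
        intro i
        have h2 := (Finset.sum_eq_zero_iff_of_nonneg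
          (fun i _ => sq_nonneg (DdV V x δ (B x i)))).1 h0 i (Finset.mem_univ i)
        exact pow_eq_zero_iff (two_ne_zero) |>.1 h2
      have h3 := hCCM x u δ hδ h1
      linarith
    have hr : rhoCCM f B V α x δ u * bCCM B V x δ = aCCM f B V α x δ u +
        Real.sqrt ((aCCM f B V α x δ u) ^ 2 + (bCCM B V x δ) ^ 2) := by
      rw [rhoCCM, if_neg hneg, div_mul_cancel₀ _ hb0]
    have hs : 0 < Real.sqrt ((aCCM f B V α x δ u) ^ 2 + (bCCM B V x δ) ^ 2) :=
      Real.sqrt_pos.2 (by positivity)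
    rw [hr]
    linarith
end
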